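/- Let k be a field of characteristic zero containing a primitive third root of unity, and let η be the k-algebra automorphism of F = k(x,y) with η(x) = y^{-1} and η(y) = xy (a Poisson monomial automorphism of order 6). Then the fixed field F^η is Poisson-isomorphic to F. -/

import Mathlib

noncomputable section

/-- A Poisson bracket on a commutative `k`-algebra `R`: a `k`-bilinear antisymmetric map
satisfying the Jacobi identity and the Leibniz rule in each argument. -/
structure PoissonBracket (k R : Type*) [CommRing k] [CommRing R] [Algebra k R] where
  bracket : R →ₗ[k] R →ₗ[k] R
  antisymm : ∀ a b : R, bracket a b = - bracket b a
  jacobi : ∀ a b c : R,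
    bracket a (bracket b c) + bracket b (bracket c a) + bracket c (bracket a b) = 0
  leibniz : ∀ a b c : R, bracket a (b * c) = bracket a b * c + b * bracket a c

/-- The subalgebra of elements fixed by an algebra automorphism. -/
def fixedSubalgebra {k F : Type*} [CommSemiring k] [CommSemiring F] [Algebra k F]
    (σ : F ≃ₐ[k] F) : Subalgebra k F where
  carrier := {a | σ a = a}
  mul_mem' := fun {a b} ha hb => by
    show σ (a * b) = a * b
    rw [map_mul, show σ a = a from ha, show σ b = b from hb]
  add_mem' := fun {a b} ha hb => by
    show σ (a + b) = a + b
    rw [map_add, show σ a = a from ha, show σ b = b from hb]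
  one_mem' := map_one σ
  zero_mem' := map_zero σ
  algebraMap_mem' := fun r => σ.commutes r

namespace PoissonBracket

section Field

variable {k F : Type*} [Field k] [Field F] [Algebra k F] (P : PoissonBracket k F)

/-- The Hamiltonian derivation `{a, ·}`. -/
def hamiltonian (a : F) : Derivation k F F :=
  Derivation.mk' (P.bracket a) fun b c => by
    rw [P.leibniz, smul_eq_mul, smul_eq_mul]; ring

theorem bracket_algebraMap (a : F) (r : k) : P.bracket a (algebraMap k F r) = 0 :=
  (P.hamiltonian a).map_algebraMap r

theorem bracket_one (a : F) : P.bracket a 1 = 0 :=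
  (P.hamiltonian a).map_one_eq_zero

theorem algebraMap_bracket (a : F) (r : k) : P.bracket (algebraMap k F r) a = 0 := by
  rw [P.antisymm, bracket_algebraMap, neg_zero]

theorem one_bracket (a : F) : P.bracket 1 a = 0 := by
  rw [P.antisymm, bracket_one, neg_zero]

theorem mul_bracket (a b c : F) :
    P.bracket (a * b) c = P.bracket a c * b + a * P.bracket b c := by
  rw [P.antisymm, P.leibniz, P.antisymm c a, P.antisymm c b]; ring

theorem bracket_inv (a b : F) : P.bracket a b⁻¹ = -(P.bracket a b) * b⁻¹ ^ 2 := by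
  have := (P.hamiltonian a).leibniz_inv b
  rw [smul_eq_mul] at this
  exact this.trans (by simp [hamiltonian, mul_comm])

theorem inv_bracket (a b : F) : P.bracket a⁻¹ b = -(P.bracket a b) * a⁻¹ ^ 2 := by
  rw [P.antisymm, bracket_inv, P.antisymm b a]; ring

theorem bracket_self [CharZero k] (a : F) : P.bracket a a = 0 := by
  have : CharZero F := charZero_of_injective_algebraMap (algebraMap k F).injective
  exact self_eq_neg.1 (P.antisymm a a)

/-- Two Poisson brackets agreeing on generators are intertwined by a field morphism. -/
theorem map_bracket_of_adjoin_pair [CharZero k] {K : Type*} [Field K] [Algebra k K]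
    (Q : PoissonBracket k K) (φ : F →ₐ[k] K) {x y : F}
    (hgen : IntermediateField.adjoin k {x, y} = ⊤)
    (h : φ (P.bracket y x) = Q.bracket (φ y) (φ x)) (a b : F) :
    φ (P.bracket a b) = Q.bracket (φ a) (φ b) := by
  have extend : ∀ a : F, φ (P.bracket a x) = Q.bracket (φ a) (φ x) →
      φ (P.bracket a y) = Q.bracket (φ a) (φ y) →
      ∀ b, φ (P.bracket a b) = Q.bracket (φ a) (φ b) := by
    intro a hx hy b
    have hb : b ∈ IntermediateField.adjoin k {x, y} := hgen ▸ IntermediateField.mem_top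
    induction hb using IntermediateField.adjoin_induction with
    | mem u hu => rcases hu with rfl | rfl <;> assumption
    | algebraMap r => simp [bracket_algebraMap]
    | add u v _ _ hu hv => simp [hu, hv]
    | inv u _ hu => simp [bracket_inv, hu]
    | mul u v _ _ hu hv => simp [leibniz, hu, hv]
  have swap : ∀ a b : F, φ (P.bracket a b) = Q.bracket (φ a) (φ b) →
      φ (P.bracket b a) = Q.bracket (φ b) (φ a) := by
    intro a b hab
    rw [P.antisymm, Q.antisymm, map_neg, hab]
  have hx := extend x (by simp [bracket_self]) (swap _ _ h)
  have hy := extend y h (by simp [bracket_self])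
  exact extend a (swap _ _ (hx a)) (swap _ _ (hy a)) b

end Field

/-- The bracket of the invariants `x + x⁻¹` and `y + y⁻¹` of the inversion of the torus. -/
theorem bracket_add_inv {k F : Type*} [Field k] [Field F] [Algebra k F] (P : PoissonBracket k F)
    {x y : F} (hx : x ≠ 0) (hy : y ≠ 0)
    (hP : P.bracket y x = y * x) :
    P.bracket (x + x⁻¹) (y + y⁻¹) =
      (x + x⁻¹) * (y + y⁻¹) - 2 * (x * y + (x * y)⁻¹) := by
  have h : P.bracket x y = -(y * x) := by rw [P.antisymm, hP]
  simp only [map_add, LinearMap.add_apply, inv_bracket, bracket_inv, h]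
  field_simp
  ring

/-- The brackets of the eigenvectors of the cyclic permutation of `a`, `b`, `c`, with the invariant
one recentred at the node `a = b = c = 2` of the cubic surface. -/
theorem bracket_eigen {k F : Type*} [Field k] [CharZero k] [Field F] [Algebra k F]
    (P : PoissonBracket k F) {ω : k} (hω : ω ^ 2 + ω + 1 = 0) {a b c : F}
    (hab : P.bracket a b = a * b - 2 * c) (hbc : P.bracket b c = b * c - 2 * a)
    (hca : P.bracket c a = c * a - 2 * b) {o p q z : F} (ho : o = algebraMap k F ω)
    (hp : p = a + o * b + o ^ 2 * c) (hq : q = a + o ^ 2 * b + o * c)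
    (hz : z = a + b + c - 6) :
    3 * P.bracket p q = (o ^ 2 - o) * (z ^ 2 + 6 * z - p * q) ∧
    3 * P.bracket q z = (o ^ 2 - o) * (p ^ 2 - q * z - 12 * q) ∧
    3 * P.bracket z p = (o ^ 2 - o) * (q ^ 2 - p * z - 12 * p) := by
  have ho2 : o ^ 2 = - o - 1 := by
    have := congrArg (algebraMap k F) hω
    simp only [map_add, map_pow, map_one, map_zero, ← ho] at this
    linear_combination this
  have h6 : (6 : F) = algebraMap k F 6 := (map_ofNat _ 6).symm
  have hba : P.bracket b a = -(a * b - 2 * c) := by rw [P.antisymm, hab]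
  have hcb : P.bracket c b = -(b * c - 2 * a) := by rw [P.antisymm, hbc]
  have hac : P.bracket a c = -(c * a - 2 * b) := by rw [P.antisymm, hca]
  have hl : ∀ u : F, P.bracket o u = 0 := fun u => by rw [ho, P.algebraMap_bracket]
  have hr : ∀ u : F, P.bracket u o = 0 := fun u => by rw [ho, P.bracket_algebraMap]
  have hl6 : ∀ u : F, P.bracket 6 u = 0 := fun u => by rw [h6, P.algebraMap_bracket]
  have hr6 : ∀ u : F, P.bracket u 6 = 0 := fun u => by rw [h6, P.bracket_algebraMap]
  subst hp hq hz
  rw [ho2]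
  simp only [map_add, map_sub, map_neg, LinearMap.sub_apply, LinearMap.add_apply,
    LinearMap.neg_apply, leibniz, mul_bracket, hl, hr, hl6, hr6, bracket_self, one_bracket,
    bracket_one, hab, hbc, hca, hba, hcb, hac]
  refine ⟨?_, ?_, ?_⟩
  · ring_nf
    rw [show o ^ 3 = 1 by linear_combination (o - 1) * ho2, ho2]; ring_nf
  · ring_nf
    rw [show o ^ 3 = 1 by linear_combination (o - 1) * ho2, ho2]; ring_nf
  · ring_nf
    rw [show o ^ 3 = 1 by linear_combination (o - 1) * ho2, ho2]; ring_nf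

/-- The bracket in the rational chart obtained by projecting the quotient cubic surface
from its node: it vanishes along a nodal cubic. -/
theorem bracket_chart {k F : Type*} [Field k] [CharZero k] [Field F] [Algebra k F]
    (P : PoissonBracket k F) {p q z c : F} (hp : p ≠ 0) (hq : q ≠ 0) (hz : z ≠ 0)
    (hpq : 3 * P.bracket p q = c * (z ^ 2 + 6 * z - p * q))
    (hqz : 3 * P.bracket q z = c * (p ^ 2 - q * z - 12 * q))
    (hzp : 3 * P.bracket z p = c * (q ^ 2 - p * z - 12 * p))
    (hrel : p ^ 3 + q ^ 3 - 3 * p * q * z - 36 * p * q + z ^ 3 + 9 * z ^ 2 = 0)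
    {α β : F} (hα : α = p ^ 2 / (q * z)) (hβ : β = q ^ 2 / (p * z)) :
    3 * P.bracket α β = c * (α * β * (α + β - 3) + 1) := by
  have hqp : P.bracket q p = - P.bracket p q := P.antisymm _ _
  have hzq : P.bracket z q = - P.bracket q z := P.antisymm _ _
  have hpz : P.bracket p z = - P.bracket z p := P.antisymm _ _
  have key : P.bracket α β * z ^ 3 =
      3 * (z * P.bracket p q + p * P.bracket q z + q * P.bracket z p) := by
    subst hα hβ
    simp only [div_eq_mul_inv, pow_two, leibniz, mul_bracket, bracket_inv, inv_bracket,
      bracket_self, hqp, hzq, hpz]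
    field_simp
    ring
  have hA : (α * β * (α + β - 3) + 1) * z ^ 3 = p ^ 3 + q ^ 3 + z ^ 3 - 3 * p * q * z := by
    subst hα hβ
    field_simp
    ring
  apply mul_right_cancel₀ (pow_ne_zero 3 hz)
  linear_combination 3 * key + 3 * z * hpq + 3 * p * hqz + 3 * q * hzp - c * hA + 2 * c * hrel

/-- Blowing up the node `(1, 1)` of the nodal cubic yields log-canonical coordinates. -/
theorem bracket_log {k F : Type*} [Field k] [CharZero k] [Field F] [Algebra k F]
    (P : PoissonBracket k F) {ω : k} (hω : ω ^ 2 + ω + 1 = 0) {o α β t G V W : F}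
    (ho : o = algebraMap k F ω)
    (h : 3 * P.bracket α β = (o ^ 2 - o) * (α * β * (α + β - 3) + 1))
    (hα : α - 1 ≠ 0) (hG : G = (α - 1)⁻¹) (ht : t = (β - 1) * G)
    (hV : V = G * (1 + t + t ^ 2) + t * (1 + t))
    (hto : t - o ^ 2 ≠ 0) (hW : W = (t - o) / (t - o ^ 2)) :
    P.bracket W V = W * V := by
  have : CharZero F := charZero_of_injective_algebraMap (algebraMap k F).injective
  have ho2 : o ^ 2 = - o - 1 := by
    have := congrArg (algebraMap k F) hω
    simp only [map_add, map_pow, map_one, map_zero, ← ho] at this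
    linear_combination this
  have hl : ∀ u : F, P.bracket o u = 0 := fun u => by rw [ho, P.algebraMap_bracket]
  have hr : ∀ u : F, P.bracket u o = 0 := fun u => by rw [ho, P.bracket_algebraMap]
  have hba : P.bracket β α = - P.bracket α β := P.antisymm _ _
  have hGt : 3 * P.bracket t G = (o ^ 2 - o) * V := by
    have hA : V * (α - 1) ^ 3 = α * β * (α + β - 3) + 1 := by
      subst hV ht hG
      field_simp
      ring
    rw [← hA] at h
    have : P.bracket t G * (α - 1) ^ 3 = P.bracket α β := by
      subst ht hG
      simp only [mul_bracket, bracket_inv, inv_bracket, map_sub, LinearMap.sub_apply,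
        bracket_self, hba, bracket_one, one_bracket]
      field_simp
      ring
    apply mul_right_cancel₀ (pow_ne_zero 3 hα)
    linear_combination h + 3 * this
  have htV : P.bracket t V = (1 + t + t ^ 2) * P.bracket t G := by
    subst hV
    simp only [pow_two, leibniz, map_add, bracket_self, bracket_one]
    ring
  have hWV : P.bracket W V * (t - o ^ 2) ^ 2 = (o - o ^ 2) * P.bracket t V := by
    subst hW
    simp only [div_eq_mul_inv, pow_two, mul_bracket, inv_bracket, map_sub, LinearMap.sub_apply,
      hl]
    field_simp
    ring
  have hWt : W * (t - o ^ 2) = t - o := by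
    subst hW
    field_simp
  have h3 : (3 : F) ≠ 0 := by norm_num
  apply mul_right_cancel₀ (pow_ne_zero 2 hto)
  apply mul_right_cancel₀ h3
  have e1 : (o - o ^ 2) * (o ^ 2 - o) = 3 := by
    linear_combination (-o ^ 2 + 3 * o - 3) * ho2
  have e2 : 1 + t + t ^ 2 = (t - o) * (t - o ^ 2) := by
    linear_combination (t - o + 1) * ho2
  rw [hWV, htV, e2]
  linear_combination ((o - o ^ 2) * (t - o) * (t - o ^ 2)) * hGt +
    V * (t - o) * (t - o ^ 2) * e1 - 3 * V * (t - o ^ 2) * hWt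
end PoissonBracket

open Polynomial in
theorem IntermediateField.exists_aeval_eq_of_mem_adjoin_simple {K F : Type*} [Field K] [Field F]
    [Algebra K F] {x f : F} (hf : f ∈ IntermediateField.adjoin K {x}) {q : K[X]}
    (hq : q.Monic) (hx : aeval x q = 0) :
    ∃ r : K[X], r.degree < q.degree ∧ aeval x r = f := by
  have hint : IsIntegral K x := ⟨q, hq, by simpa [aeval_def] using hx⟩
  rw [← IntermediateField.mem_toSubalgebra,
    IntermediateField.adjoin_simple_toSubalgebra_of_isAlgebraic hint.isAlgebraic,
    Algebra.adjoin_singleton_eq_range_aeval] at hf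
  obtain ⟨r, rfl⟩ := hf
  exact ⟨r %ₘ q, degree_modByMonic_lt r hq, by
    rw [aeval_modByMonic_eq_self_of_root hx]; rfl⟩

open Polynomial in
theorem IntermediateField.exists_of_mem_adjoin_of_add_inv_mem {K F : Type*} [Field K] [Field F]
    [Algebra K F] {x f : F} (hx : x ≠ 0) (a : K) (ha : algebraMap K F a = x + x⁻¹)
    (hf : f ∈ IntermediateField.adjoin K {x}) :
    ∃ A B : K, f = algebraMap K F A + algebraMap K F B * x := by
  have hdeg : (X ^ 2 + C (-a) * X + C 1 : K[X]).natDegree = 2 := by compute_degree!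
  have hm : (X ^ 2 + C (-a) * X + C 1 : K[X]).Monic := by monicity!
  obtain ⟨r, hr, rfl⟩ := exists_aeval_eq_of_mem_adjoin_simple hf hm (by
    simp only [map_add, map_mul, map_pow, aeval_X, aeval_C, map_neg, ha, map_one]
    field_simp
    ring)
  have hr' : r.degree < 2 := by
    rwa [degree_eq_natDegree hm.ne_zero, hdeg] at hr
  obtain rfl | h0 := eq_or_ne r 0
  · exact ⟨0, 0, by simp⟩
  obtain ⟨B, A, h⟩ := exists_eq_X_add_C_of_natDegree_le_one
    (Nat.lt_succ_iff.1 ((natDegree_lt_iff_degree_lt h0).2 hr'))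
  exact ⟨A, B, by rw [h]; simp [add_comm]⟩

open Polynomial in
theorem IntermediateField.exists_of_mem_adjoin_of_pow_three_mem {K F : Type*} [Field K] [Field F]
    [Algebra K F] {p f : F} (a : K) (ha : algebraMap K F a = p ^ 3)
    (hf : f ∈ IntermediateField.adjoin K {p}) :
    ∃ A B C : K, f = algebraMap K F A + algebraMap K F B * p + algebraMap K F C * p ^ 2 := by
  have hm : (X ^ 3 - C a : K[X]).Monic := monic_X_pow_sub_C a three_ne_zero
  obtain ⟨r, hr, rfl⟩ := exists_aeval_eq_of_mem_adjoin_simple hf hm (by simp [ha])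
  have hr' : r.degree < 3 := by rwa [degree_X_pow_sub_C three_pos] at hr
  refine ⟨r.coeff 0, r.coeff 1, r.coeff 2, ?_⟩
  conv_lhs => rw [as_sum_range' r 3 (by
    obtain rfl | h0 := eq_or_ne r 0
    · simp
    exact (natDegree_lt_iff_degree_lt h0).2 hr')]
  simp [Finset.sum_range_succ, aeval_monomial]

/-- Let `F` be obtained from `L` by adjoining a cube root `p` and then a solution `x` of a
reciprocal quadratic equation. If `η` fixes `L`, scales `p` by a primitive cube root of unity and
`η ^ 3` inverts `x`, then the elements fixed by `η` lie in `L`. -/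
theorem fixed_mem_of_tower {k F : Type*} [Field k] [Field F] [CharZero F] [Algebra k F]
    (L : IntermediateField k F) (η : F ≃ₐ[k] F) (hL : ∀ l ∈ L, η l = l) {o p x f : F}
    (ho : o ^ 2 = -o - 1) (hoL : o ∈ L)
    (hp3 : p ^ 3 ∈ L) (hηp : η p = o ^ 2 * p) (hx : x ≠ 0) (hxx : x ≠ x⁻¹)
    (hηx : η (η (η x)) = x⁻¹) (ha : x + x⁻¹ ∈ IntermediateField.adjoin L {p})
    (htop : IntermediateField.adjoin (IntermediateField.adjoin L {p}) {x} = ⊤)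
    (hf : η f = f) : f ∈ L := by
  have hL' : ∀ l : L, η (algebraMap L F l) = algebraMap L F l := fun l => hL _ l.2
  have hηo : η o = o := hL o hoL
  have ho3 : o ^ 3 = 1 := by linear_combination (o - 1) * ho
  have hM (u : IntermediateField.adjoin L {p}) : η (η (η (u : F))) = u := by
    obtain ⟨A, B, C, h⟩ := IntermediateField.exists_of_mem_adjoin_of_pow_three_mem
      ⟨p ^ 3, hp3⟩ rfl u.2
    rw [h]
    simp only [map_add, map_mul, map_pow, hL', hηp, hηo]
    linear_combination (algebraMap L F B * p * (o ^ 3 + 1) + algebraMap L F C * p ^ 2 *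
      (o ^ 9 + o ^ 6 + o ^ 3 + 1)) * ho3
  obtain ⟨A, B, hAB⟩ := IntermediateField.exists_of_mem_adjoin_of_add_inv_mem (f := f) hx
    ⟨x + x⁻¹, ha⟩ rfl (htop ▸ IntermediateField.mem_top)
  have hfA : f = (A : F) := by
    have h1 : η (η (η f)) = (A : F) + (B : F) * x⁻¹ := by
      rw [hAB]
      change η (η (η ((A : F) + (B : F) * x))) = _
      simp only [map_add, map_mul, hM, hηx]
    rw [hf, hf, hf, hAB] at h1
    change (A : F) + (B : F) * x = _ at h1
    have h2 : (B : F) * (x - x⁻¹) = 0 := by linear_combination h1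
    have h3 := (mul_eq_zero.1 h2).resolve_right (sub_ne_zero.2 hxx)
    rw [hAB]
    change (A : F) + (B : F) * x = A
    rw [h3]
    ring
  obtain ⟨l, m, n, h⟩ := IntermediateField.exists_of_mem_adjoin_of_pow_three_mem
      ⟨p ^ 3, hp3⟩ rfl A.2
  rw [← hfA] at h
  have h1 : f = algebraMap L F l + algebraMap L F m * (o ^ 2 * p) +
      algebraMap L F n * (o ^ 2 * p) ^ 2 := by
    conv_lhs => rw [← hf, h]
    simp only [map_add, map_mul, map_pow, hL', hηp]
  have h2 : f = algebraMap L F l + algebraMap L F m * (o ^ 2 * (o ^ 2 * p)) +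
      algebraMap L F n * (o ^ 2 * (o ^ 2 * p)) ^ 2 := by
    conv_lhs => rw [← hf, h1]
    simp only [map_add, map_mul, map_pow, hL', hηp, hηo]
  have h3 : 3 * f = 3 * algebraMap L F l := by
    linear_combination h + h1 + h2 + (algebraMap L F m * p * (o ^ 2 - o + 1)
     + algebraMap L F n * p ^ 2 * (o ^ 6 - o ^ 5 + o ^ 3 - o + 1)) * ho
  rw [mul_left_cancel₀ three_ne_zero h3]
  exact l.2

/-- The log-canonical coordinates generate the invariants `z`, `p ^ 2 / q` and `q ^ 2 / p`. -/
theorem mem_of_log_mem {k F : Type*} [Field k] [Field F] [CharZero F] [Algebra k F]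
    (L : IntermediateField k F) {o p q z α β G t V W : F} (ho : o ^ 2 = -o - 1) (hoL : o ∈ L)
    (hp : p ≠ 0) (hq : q ≠ 0) (hz : z ≠ 0)
    (hrel : p ^ 3 + q ^ 3 - 3 * p * q * z - 36 * p * q + z ^ 3 + 9 * z ^ 2 = 0)
    (hA : p ^ 3 + q ^ 3 + z ^ 3 - 3 * p * q * z ≠ 0)
    (hα : α = p ^ 2 / (q * z)) (hβ : β = q ^ 2 / (p * z))
    (hα1 : α - 1 ≠ 0) (hG : G = (α - 1)⁻¹) (ht : t = (β - 1) * G)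
    (hV : V = G * (1 + t + t ^ 2) + t * (1 + t))
    (hto : t - o ≠ 0) (hto2 : t - o ^ 2 ≠ 0) (hW : W = (t - o) / (t - o ^ 2))
    (hVL : V ∈ L) (hWL : W ∈ L) :
    z ∈ L ∧ p ^ 2 / q ∈ L ∧ q ^ 2 / p ∈ L := by
  have hn (n : ℕ) [n.AtLeastTwo] : (ofNat(n) : F) ∈ L := ofNat_mem L n
  have hoo : o ^ 2 - o ≠ 0 := by
    intro h
    have h1 : (o ^ 2 - o) ^ 2 = -3 := by linear_combination (o ^ 2 - 3 * o + 3) * ho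
    rw [h] at h1
    norm_num at h1
  have hW1 : (W - 1) * (t - o ^ 2) = o ^ 2 - o := by
    rw [hW]; field_simp; ring
  have hW1' : W - 1 ≠ 0 := left_ne_zero_of_mul (hW1 ▸ hoo)
  have htL : t ∈ L := by
    have : t = (o ^ 2 * W - o) / (W - 1) := by
      rw [eq_div_iff hW1']; linear_combination hW1
    rw [this]
    exact div_mem (sub_mem (mul_mem (pow_mem hoL 2) hWL) hoL) (sub_mem hWL (one_mem L))
  have ht1L : 1 + t + t ^ 2 ∈ L := add_mem (add_mem (one_mem L) htL) (pow_mem htL 2)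
  have hGL : G ∈ L := by
    have e2 : 1 + t + t ^ 2 = (t - o) * (t - o ^ 2) := by
      linear_combination (t - o + 1) * ho
    have : G = (V - t * (1 + t)) / (1 + t + t ^ 2) := by
      rw [eq_div_iff (e2 ▸ mul_ne_zero hto hto2)]; linear_combination -hV
    rw [this]
    exact div_mem (sub_mem hVL (mul_mem htL (add_mem (one_mem L) htL))) ht1L
  have hG0 : G ≠ 0 := hG ▸ inv_ne_zero hα1
  have hαL : α ∈ L := by
    have : α = 1 + G⁻¹ := by rw [hG]; simp
    rw [this]
    exact add_mem (one_mem L) (inv_mem hGL)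
  have hβL : β ∈ L := by
    have : β = 1 + t / G := by rw [ht]; field_simp; ring
    rw [this]
    exact add_mem (one_mem L) (div_mem htL hGL)
  have hA' : (α * β * (α + β - 3) + 1) * z ^ 3 = p ^ 3 + q ^ 3 + z ^ 3 - 3 * p * q * z := by
    subst hα hβ
    field_simp
    ring
  have hA0 : α * β * (α + β - 3) + 1 ≠ 0 := left_ne_zero_of_mul (hA' ▸ hA)
  have hzL : z ∈ L := by
    have hαβ : α * β * z ^ 2 = p * q := by
      rw [hα, hβ]; field_simp
    have : z = (36 * (α * β) - 9) / (α * β * (α + β - 3) + 1) := by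
      rw [eq_div_iff hA0]
      apply mul_right_cancel₀ (pow_ne_zero 2 hz)
      linear_combination hA' + hrel - 36 * hαβ
    rw [this]
    have hαβL := mul_mem hαL hβL
    exact div_mem (sub_mem (mul_mem (hn 36) hαβL) (hn 9))
      (add_mem (mul_mem hαβL (sub_mem (add_mem hαL hβL) (hn 3))) (one_mem L))
  refine ⟨hzL, ?_, ?_⟩
  · have : p ^ 2 / q = α * z := by rw [hα]; field_simp
    exact this ▸ mul_mem hαL hzL
  · have : q ^ 2 / p = β * z := by rw [hβ]; field_simp
    exact this ▸ mul_mem hβL hzL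

theorem AlgebraicIndependent.aeval_ne_zero_of_eval_ne_zero {k F ι : Type*} [Field k] [Field F]
    [Algebra k F] {v : ι → F} (hv : AlgebraicIndependent k v) (f : MvPolynomial ι k)
    (w : ι → k) (h : MvPolynomial.eval w f ≠ 0) : MvPolynomial.aeval v f ≠ 0 := by
  intro h0
  rw [hv.eq_zero_of_aeval_eq_zero f h0, map_zero] at h
  exact h rfl

/-- A field generated by an algebraically independent family maps onto the field generated by any
other algebraically independent family with the same index type. -/
theorem AlgebraicIndependent.exists_algHom {k F K ι : Type*} [Field k] [Field F] [Field K]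
    [Algebra k F] [Algebra k K] {v : ι → F} (hv : AlgebraicIndependent k v)
    (hgen : IntermediateField.adjoin k (Set.range v) = ⊤) {w : ι → K} (hw : AlgebraicIndependent k w) :
    ∃ φ : F →ₐ[k] K, (∀ i, φ (v i) = w i) ∧ φ.fieldRange = IntermediateField.adjoin k (Set.range w) := by
  let e : F ≃ₐ[k] IntermediateField.adjoin k (Set.range w) :=
    (IntermediateField.topEquiv.symm.trans (IntermediateField.equivOfEq hgen.symm)).trans
      (hv.aevalEquivField.symm.trans hw.aevalEquivField)
  have he (i) : (e (v i) : K) = w i := by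
    have h1 : hv.aevalEquivField (algebraMap (MvPolynomial ι k) _ (MvPolynomial.X i)) =
        (IntermediateField.equivOfEq hgen.symm) (IntermediateField.topEquiv.symm (v i)) := by
      apply Subtype.ext
      rw [AlgebraicIndependent.aevalEquivField_algebraMap_apply_coe, MvPolynomial.aeval_X]
      rfl
    simp only [e, AlgEquiv.trans_apply]
    rw [← h1, AlgEquiv.symm_apply_apply,
      AlgebraicIndependent.aevalEquivField_algebraMap_apply_coe, MvPolynomial.aeval_X]
  refine ⟨(IntermediateField.adjoin k (Set.range w)).val.comp e.toAlgHom, he, ?_⟩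
  ext f
  constructor
  · rintro ⟨u, rfl⟩
    exact (e u).2
  · intro hf
    exact ⟨e.symm ⟨f, hf⟩, by simp⟩

theorem AlgebraicIndependent.of_isAlgebraic_adjoin {k F ι : Type*} [Finite ι] [Field k] [Field F]
    [Algebra k F] {v w : ι → F} (hv : AlgebraicIndependent k v)
    (halg : Algebra.IsAlgebraic (IntermediateField.adjoin k (Set.range w)) F) : AlgebraicIndependent k w := by
  have := IntermediateField.isAlgebraic_adjoin_iff_top.1 halg
  exact (Algebra.IsAlgebraic.isTranscendenceBasis_of_lift_le_trdeg_of_finite k w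
    hv.lift_cardinalMk_le_trdeg).1

theorem adjoin_tower_eq_top {k F : Type*} [Field k] [Field F] [Algebra k F]
    (L : IntermediateField k F) (M : IntermediateField L F) {x y : F}
    (hgen : IntermediateField.adjoin k {x, y} = ⊤)
    (hy : y ∈ IntermediateField.adjoin M {x}) : IntermediateField.adjoin M {x} = ⊤ := by
  rw [eq_top_iff]
  intro f _
  have hf : f ∈ IntermediateField.adjoin k {x, y} := hgen ▸ IntermediateField.mem_top
  induction hf using IntermediateField.adjoin_induction with
  | mem u hu =>
    rcases hu with rfl | rfl
    · exact IntermediateField.mem_adjoin_simple_self M _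
    · exact hy
  | algebraMap r =>
    exact (IntermediateField.adjoin M {x}).algebraMap_mem (algebraMap L M (algebraMap k L r))
  | add u v _ _ hu hv => exact add_mem (hu trivial) (hv trivial)
  | inv u _ hu => exact inv_mem (hu trivial)
  | mul u v _ _ hu hv => exact mul_mem (hu trivial) (hv trivial)

open Polynomial in
theorem isAlgebraic_of_tower_eq_top {K F : Type*} [Field K] [Field F] [Algebra K F] {p x : F}
    (hp : IsIntegral K p) (hx : x ≠ 0) (ha : x + x⁻¹ ∈ IntermediateField.adjoin K {p})
    (htop : IntermediateField.adjoin (IntermediateField.adjoin K {p}) {x} = ⊤) :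
    Algebra.IsAlgebraic K F := by
  have h1 : Algebra.IsAlgebraic K (IntermediateField.adjoin K {p}) :=
    IntermediateField.isAlgebraic_adjoin_simple hp
  have hx' : IsIntegral (IntermediateField.adjoin K {p}) x := by
    refine ⟨X ^ 2 + C (-⟨x + x⁻¹, ha⟩) * X + C 1, by monicity!, ?_⟩
    rw [← aeval_def]
    simp only [map_add, map_mul, map_pow, aeval_X, aeval_C, map_neg, map_one,
      IntermediateField.algebraMap_apply]
    field_simp
    ring
  have h2 := IntermediateField.isAlgebraic_adjoin_simple hx'
  rw [htop] at h2
  have h3 : Algebra.IsAlgebraic (IntermediateField.adjoin K {p}) F :=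
    h2.of_injective (IntermediateField.topEquiv.symm.toAlgHom)
      (IntermediateField.topEquiv.symm.injective)
  exact Algebra.IsAlgebraic.trans K (IntermediateField.adjoin K {p}) F

/-- Nonvanishing of the denominators, checked by specializing `x` and `y`. -/
theorem eigen_ne_zero {k F : Type*} [Field k] [CharZero k] [Field F] [Algebra k F] {ω : k}
    (hω2 : ω ^ 2 + ω + 1 = 0) {o x y a b c p q z : F}
    (hind : AlgebraicIndependent k ![x, y]) (hx : x ≠ 0) (hy : y ≠ 0)
    (ho : o = algebraMap k F ω)
    (ha : a = x + x⁻¹) (hb : b = y + y⁻¹) (hc : c = x * y + (x * y)⁻¹)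
    (hp : p = a + o * b + o ^ 2 * c) (hq : q = a + o ^ 2 * b + o * c) (hz : z = a + b + c - 6) :
    p ≠ 0 ∧ q ≠ 0 ∧ z ≠ 0 ∧ p ^ 2 - q * z ≠ 0 ∧
      q * (q ^ 2 - p * z) - o * (p * (p ^ 2 - q * z)) ≠ 0 ∧
      q * (q ^ 2 - p * z) - o ^ 2 * (p * (p ^ 2 - q * z)) ≠ 0 ∧
      p ^ 3 + q ^ 3 + z ^ 3 - 3 * p * q * z ≠ 0 := by
  have : CharZero F := charZero_of_injective_algebraMap (algebraMap k F).injective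
  have ho2 : o ^ 2 = - o - 1 := by
    have := congrArg (algebraMap k F) hω2
    simp only [map_add, map_pow, map_one, map_zero, ← ho] at this
    linear_combination this
  have hω1 : 1 - ω ≠ 0 := by
    intro h
    have h3 : (3 : k) = 0 := by linear_combination hω2 + (ω + 2) * h
    norm_num at h3
  have hω1' : 1 - ω ^ 2 ≠ 0 := by
    have h1 : 1 + ω ≠ 0 := by
      intro h
      have h3 : (1 : k) = 0 := by linear_combination hω2 - ω * h
      norm_num at h3
    have : 1 - ω ^ 2 = (1 - ω) * (1 + ω) := by ring
    exact this ▸ mul_ne_zero hω1 h1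
  let X : MvPolynomial (Fin 2) k := MvPolynomial.X 0
  let Y : MvPolynomial (Fin 2) k := MvPolynomial.X 1
  let A := X ^ 2 * Y + Y
  let B := X * Y ^ 2 + X
  let D := X ^ 2 * Y ^ 2 + 1
  let R := A + MvPolynomial.C ω * B + MvPolynomial.C ω ^ 2 * D
  let S := A + MvPolynomial.C ω ^ 2 * B + MvPolynomial.C ω * D
  let T := A + B + D - MvPolynomial.C 6 * X * Y
  have hR : MvPolynomial.aeval ![x, y] R = x * y * p := by
    simp only [R, A, B, D, X, Y, map_add, map_mul, map_pow, map_one, MvPolynomial.aeval_X,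
      MvPolynomial.algHom_C, Matrix.cons_val_zero, Matrix.cons_val_one, hp, ha, hb, hc, ho]
    field_simp
  have hS : MvPolynomial.aeval ![x, y] S = x * y * q := by
    simp only [S, A, B, D, X, Y, map_add, map_mul, map_pow, map_one, MvPolynomial.aeval_X,
      MvPolynomial.algHom_C, Matrix.cons_val_zero, Matrix.cons_val_one, hq, ha, hb, hc, ho]
    field_simp
  have hT : MvPolynomial.aeval ![x, y] T = x * y * z := by
    simp only [T, A, B, D, X, Y, map_add, map_sub, map_mul, map_pow, map_one,
      MvPolynomial.aeval_X, map_ofNat,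
      Matrix.cons_val_zero, Matrix.cons_val_one, hz, ha, hb, hc]
    field_simp
  have hC : MvPolynomial.aeval ![x, y] (MvPolynomial.C ω) = o := by
    rw [MvPolynomial.algHom_C, ho]
  have eR : MvPolynomial.eval ![1, -1] R = -4 := by
    simp only [R, A, B, D, X, Y, map_add, map_mul, map_pow, map_one, MvPolynomial.eval_X,
      MvPolynomial.eval_C, Matrix.cons_val_zero, Matrix.cons_val_one]
    linear_combination 2 * hω2
  have eS : MvPolynomial.eval ![1, -1] S = -4 := by
    simp only [S, A, B, D, X, Y, map_add, map_mul, map_pow, map_one, MvPolynomial.eval_X,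
      MvPolynomial.eval_C, Matrix.cons_val_zero, Matrix.cons_val_one]
    linear_combination 2 * hω2
  have eT : MvPolynomial.eval ![1, -1] T = 8 := by
    simp only [T, A, B, D, X, Y, map_add, map_sub, map_mul, map_pow, map_one,
      MvPolynomial.eval_X, MvPolynomial.eval_C, Matrix.cons_val_zero, Matrix.cons_val_one]
    norm_num
  have nz := hind.aeval_ne_zero_of_eval_ne_zero
  have h1 := nz R ![1, -1] (by rw [eR]; norm_num)
  have h2 := nz S ![1, -1] (by rw [eS]; norm_num)
  have h3 := nz T ![1, -1] (by rw [eT]; norm_num)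
  have h4 := nz (R ^ 2 - S * T) ![1, -1] (by
    simp only [map_sub, map_pow, map_mul, eR, eS, eT]; norm_num)
  have h5 := nz (S * (S ^ 2 - R * T) - MvPolynomial.C ω * (R * (R ^ 2 - S * T))) ![1, -1] (by
    simp only [map_sub, map_pow, map_mul, eR, eS, eT, MvPolynomial.eval_C]
    intro h
    apply mul_ne_zero (show (-192 : k) ≠ 0 by norm_num) hω1
    linear_combination h)
  have h6 := nz (S * (S ^ 2 - R * T) - MvPolynomial.C ω ^ 2 * (R * (R ^ 2 - S * T))) ![1, -1] (by
    simp only [map_sub, map_pow, map_mul, eR, eS, eT, MvPolynomial.eval_C]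
    intro h
    apply mul_ne_zero (show (-192 : k) ≠ 0 by norm_num) hω1'
    linear_combination h)
  have h7 := nz (X - 1) ![2, 2] (by simp [X]; norm_num)
  have h8 := nz (Y - 1) ![2, 2] (by simp [Y]; norm_num)
  have h9 := nz (X * Y - 1) ![2, 2] (by simp [X, Y]; norm_num)
  simp only [map_sub, map_pow, map_mul, hR, hS, hT, hC] at h1 h2 h3 h4 h5 h6
  simp only [X, Y, map_sub, map_mul, map_one, MvPolynomial.aeval_X, Matrix.cons_val_zero,
    Matrix.cons_val_one] at h7 h8 h9
  refine ⟨right_ne_zero_of_mul h1, right_ne_zero_of_mul h2, right_ne_zero_of_mul h3,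
    fun h => h4 ?_, fun h => h5 ?_, fun h => h6 ?_, ?_⟩
  · linear_combination (x * y) ^ 2 * h
  · linear_combination (x * y) ^ 3 * h
  · linear_combination (x * y) ^ 3 * h
  · have e : ∀ u : F, u ≠ 0 → u - 1 ≠ 0 → u + u⁻¹ - 2 ≠ 0 := by
      intro u hu hu1
      have : u + u⁻¹ - 2 = (u - 1) ^ 2 / u := by field_simp; ring
      rw [this]
      exact div_ne_zero (pow_ne_zero 2 hu1) hu
    have hfac : p ^ 3 + q ^ 3 + z ^ 3 - 3 * p * q * z =
        27 * ((a - 2) * (b - 2) * (c - 2)) := by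
      rw [hp, hq, hz, ho2]
      ring_nf
      rw [ho2]
      ring
    rw [hfac, ha, hb, hc]
    exact mul_ne_zero (by norm_num)
      (mul_ne_zero (mul_ne_zero (e x hx h7) (e y hy h8)) (e _ (mul_ne_zero hx hy) h9))

/-- Let `k` be a field of characteristic zero containing a primitive third
root of unity, let `F = k(x,y)` carry the Poisson bracket with `{y,x} = yx`, and let `η` be
the `k`-algebra automorphism of `F` with `η(x) = y⁻¹`, `η(y) = xy` (a Poisson monomial
automorphism of order 6).  Then the fixed field `F^η` is Poisson-isomorphic to `F`. -/
theorem statement3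
    (k : Type*) [Field k] [CharZero k] (ω : k) (hω : IsPrimitiveRoot ω 3)
    (F : Type*) [Field F] [Algebra k F] (x y : F)
    (hind : AlgebraicIndependent k ![x, y])
    (hgen : IntermediateField.adjoin k {x, y} = ⊤)
    (P : PoissonBracket k F) (hP : P.bracket y x = y * x)
    (η : F ≃ₐ[k] F) (hηx : η x = y⁻¹) (hηy : η y = x * y)
    (hηP : ∀ a b : F, η (P.bracket a b) = P.bracket (η a) (η b)) :
    ∃ e : ↥(fixedSubalgebra η) ≃ₐ[k] F,
      ∀ (u v : ↥(fixedSubalgebra η)) (huv : P.bracket (u : F) (v : F) ∈ fixedSubalgebra η),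
        e ⟨P.bracket (u : F) (v : F), huv⟩ = P.bracket (e u) (e v) := by
  have hCF : CharZero F := charZero_of_injective_algebraMap (algebraMap k F).injective
  have hx : x ≠ 0 := hind.ne_zero 0
  have hy : y ≠ 0 := hind.ne_zero 1
  have hω2 : ω ^ 2 + ω + 1 = 0 := by
    have := hω.geom_sum_eq_zero (by norm_num)
    simp only [Finset.sum_range_succ, Finset.sum_range_zero] at this
    linear_combination this
  obtain ⟨o, ho⟩ : ∃ o, o = algebraMap k F ω := ⟨_, rfl⟩
  have ho2 : o ^ 2 = - o - 1 := by
    have := congrArg (algebraMap k F) hω2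
    simp only [map_add, map_pow, map_one, map_zero, ← ho] at this
    linear_combination this
  have ho3 : o ^ 3 = 1 := by linear_combination (o - 1) * ho2
  have ho0 : o ≠ 0 := by rintro rfl; simp at ho3
  obtain ⟨a, ha⟩ : ∃ a, a = x + x⁻¹ := ⟨_, rfl⟩
  obtain ⟨b, hb⟩ : ∃ b, b = y + y⁻¹ := ⟨_, rfl⟩
  obtain ⟨c, hc⟩ : ∃ c, c = x * y + (x * y)⁻¹ := ⟨_, rfl⟩
  obtain ⟨p, hp⟩ : ∃ p, p = a + o * b + o ^ 2 * c := ⟨_, rfl⟩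
  obtain ⟨q, hq⟩ : ∃ q, q = a + o ^ 2 * b + o * c := ⟨_, rfl⟩
  obtain ⟨z, hz⟩ : ∃ z, z = a + b + c - 6 := ⟨_, rfl⟩
  obtain ⟨α, hα⟩ : ∃ α, α = p ^ 2 / (q * z) := ⟨_, rfl⟩
  obtain ⟨β, hβ⟩ : ∃ β, β = q ^ 2 / (p * z) := ⟨_, rfl⟩
  obtain ⟨G, hG⟩ : ∃ G, G = (α - 1)⁻¹ := ⟨_, rfl⟩
  obtain ⟨t, ht⟩ : ∃ t, t = (β - 1) * G := ⟨_, rfl⟩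
  obtain ⟨V, hV⟩ : ∃ V, V = G * (1 + t + t ^ 2) + t * (1 + t) := ⟨_, rfl⟩
  obtain ⟨W, hW⟩ : ∃ W, W = (t - o) / (t - o ^ 2) := ⟨_, rfl⟩
  obtain ⟨hp0, hq0, hz0, hpqz, hto', hto2', hA⟩ :=
    eigen_ne_zero hω2 hind hx hy ho ha hb hc hp hq hz
  have hα1 : α - 1 ≠ 0 := by
    have : α - 1 = (p ^ 2 - q * z) / (q * z) := by rw [hα]; field_simp
    exact this ▸ div_ne_zero hpqz (mul_ne_zero hq0 hz0)
  have ht' : t * (p * (p ^ 2 - q * z)) = q * (q ^ 2 - p * z) := by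
    have h1 : (α - 1) * (q * z) = p ^ 2 - q * z := by rw [hα]; field_simp
    have h2 : (β - 1) * (p * z) = q ^ 2 - p * z := by rw [hβ]; field_simp
    rw [← h1, ← h2, ht, hG]
    field_simp
  have hto : t - o ≠ 0 := fun h => hto' (by
    linear_combination (p * (p ^ 2 - q * z)) * h - ht')
  have hto2 : t - o ^ 2 ≠ 0 := fun h => hto2' (by
    linear_combination (p * (p ^ 2 - q * z)) * h - ht')
  have hrel : p ^ 3 + q ^ 3 - 3 * p * q * z - 36 * p * q + z ^ 3 + 9 * z ^ 2 = 0 := by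
    have h1 : a ^ 2 + b ^ 2 + c ^ 2 - a * b * c - 4 = 0 := by
      rw [ha, hb, hc]; field_simp; ring
    rw [hp, hq, hz, ho2]
    ring_nf
    rw [ho2]
    linear_combination (-27) * h1
  -- the Poisson bracket of the two generators
  have hab : P.bracket a b = a * b - 2 * c := by
    rw [ha, hb, hc]; exact P.bracket_add_inv hx hy hP
  have hηa : η a = b := by rw [ha, hb, map_add, map_inv₀, hηx, inv_inv, add_comm]
  have hηb : η b = c := by rw [hb, hc, map_add, map_inv₀, hηy]
  have hηc : η c = a := by
    rw [hc, ha, map_add, map_inv₀, map_mul, hηx, hηy]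
    field_simp
  have hbc : P.bracket b c = b * c - 2 * a := by
    have := congrArg η hab
    simpa only [hηP, map_sub, map_mul, hηa, hηb, hηc, map_ofNat] using this
  have hca : P.bracket c a = c * a - 2 * b := by
    have := congrArg η hbc
    simpa only [hηP, map_sub, map_mul, hηa, hηb, hηc, map_ofNat] using this
  obtain ⟨hpq, hqz, hzp⟩ := P.bracket_eigen hω2 hab hbc hca ho hp hq hz
  have hαβ := P.bracket_chart hp0 hq0 hz0 hpq hqz hzp hrel hα hβ
  have hWV : P.bracket W V = W * V := P.bracket_log hω2 ho hαβ hα1 hG ht hV hto2 hW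
  -- the generators are fixed
  have hηo : η o = o := by rw [ho, η.commutes]
  have hηp : η p = o ^ 2 * p := by
    rw [hp]
    simp only [map_add, map_mul, map_pow, hηo, hηa, hηb, hηc]
    linear_combination (-b - o * c) * ho3
  have hηq : η q = o * q := by
    rw [hq]
    simp only [map_add, map_mul, map_pow, hηo, hηa, hηb, hηc]
    linear_combination -b * ho3
  have hηz : η z = z := by
    rw [hz]
    simp only [map_add, map_sub, map_ofNat, hηa, hηb, hηc]
    ring
  have hηα : η α = α := by
    rw [hα]
    simp only [map_div₀, map_mul, map_pow, hηp, hηq, hηz]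
    field_simp
    linear_combination ho3
  have hηβ : η β = β := by
    rw [hβ]
    simp only [map_div₀, map_mul, map_pow, hηp, hηq, hηz]
    field_simp
  have hηG : η G = G := by rw [hG, map_inv₀, map_sub, hηα, map_one]
  have hηt : η t = t := by rw [ht, map_mul, map_sub, hηβ, map_one, hηG]
  have hηV : η V = V := by
    rw [hV]; simp only [map_add, map_mul, map_pow, map_one, hηG, hηt]
  have hηW : η W = W := by
    rw [hW]; simp only [map_div₀, map_sub, map_pow, hηt, hηo]
  obtain ⟨L, hL⟩ : ∃ L, L = IntermediateField.adjoin k (Set.range ![V, W]) := ⟨_, rfl⟩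
  have hVL : V ∈ L := hL ▸ IntermediateField.subset_adjoin k _ ⟨0, rfl⟩
  have hWL : W ∈ L := hL ▸ IntermediateField.subset_adjoin k _ ⟨1, rfl⟩
  have hoL : o ∈ L := ho ▸ L.algebraMap_mem ω
  have hLη : ∀ l ∈ L, η l = l := by
    intro l hl
    rw [hL] at hl
    induction hl using IntermediateField.adjoin_induction with
    | mem u hu =>
      obtain ⟨i, rfl⟩ := hu
      fin_cases i
      · exact hηV
      · exact hηW
    | algebraMap r => exact η.commutes r
    | add u v _ _ hu hv => rw [map_add, hu, hv]
    | inv u _ hu => rw [map_inv₀, hu]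
    | mul u v _ _ hu hv => rw [map_mul, hu, hv]
  -- the field over them is a tower of degrees three and two
  obtain ⟨hzL, hmL, hnL⟩ := mem_of_log_mem L ho2 hoL hp0 hq0 hz0 hrel hA hα hβ hα1 hG ht hV
    hto hto2 hW hVL hWL
  have hp3 : p ^ 3 ∈ L := by
    have : p ^ 3 = (p ^ 2 / q) ^ 2 * (q ^ 2 / p) := by field_simp
    exact this ▸ mul_mem (pow_mem hmL 2) hnL
  obtain ⟨M, hM⟩ : ∃ M, M = IntermediateField.adjoin L {p} := ⟨_, rfl⟩
  have hLM : ∀ u ∈ L, u ∈ M := fun u hu => M.algebraMap_mem ⟨u, hu⟩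
  have hpM : p ∈ M := hM ▸ IntermediateField.mem_adjoin_simple_self L p
  have hqM : q ∈ M := by
    have : q = p ^ 2 / (p ^ 2 / q) := by field_simp
    rw [this]
    exact div_mem (pow_mem hpM 2) (hLM _ hmL)
  have hoM := hLM o hoL
  have h3 : (3 : F) ∈ M := ofNat_mem M 3
  have hsM : z + 6 ∈ M := add_mem (hLM _ hzL) (ofNat_mem M 6)
  have haM : a ∈ M := by
    have : a = (z + 6 + p + q) / 3 := by
      rw [hz, hp, hq, ho2]; ring
    rw [this]
    exact div_mem (add_mem (add_mem hsM hpM) hqM) h3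
  have hbM : b ∈ M := by
    have : b = (z + 6 + o ^ 2 * p + o * q) / 3 := by
      rw [hz, hp, hq]
      linear_combination (- a / 3 - 2 * b / 3 * (o - 1) - c / 3 * (o ^ 2 - o + 1)) * ho2
    rw [this]
    exact div_mem (add_mem (add_mem hsM (mul_mem (pow_mem hoM 2) hpM)) (mul_mem hoM hqM)) h3
  have hcM : c ∈ M := by
    have : c = (z + 6 + o * p + o ^ 2 * q) / 3 := by
      rw [hz, hp, hq]
      linear_combination (- a / 3 - 2 * c / 3 * (o - 1) - b / 3 * (o ^ 2 - o + 1)) * ho2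
    rw [this]
    exact div_mem (add_mem (add_mem hsM (mul_mem hoM hpM)) (mul_mem (pow_mem hoM 2) hqM)) h3
  have hxx : x ≠ x⁻¹ := by
    have h := hind.aeval_ne_zero_of_eval_ne_zero (MvPolynomial.X 0 ^ 2 - 1) ![2, 2]
      (by simp; norm_num)
    simp only [map_sub, map_pow, map_one, MvPolynomial.aeval_X, Matrix.cons_val_zero] at h
    intro h'
    apply h
    field_simp at h'
    linear_combination h'
  have hyN : y ∈ IntermediateField.adjoin M {x} := by
    have hMN : ∀ u ∈ M, u ∈ IntermediateField.adjoin M {x} := fun u hu =>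
      (IntermediateField.adjoin M {x}).algebraMap_mem ⟨u, hu⟩
    have hxN := IntermediateField.mem_adjoin_simple_self M x
    have : y = (c - b * x⁻¹) / (x - x⁻¹) := by
      rw [eq_div_iff (sub_ne_zero.2 hxx), hc, hb]
      field_simp
      ring
    rw [this]
    exact div_mem (sub_mem (hMN c hcM) (mul_mem (hMN b hbM) (inv_mem hxN)))
      (sub_mem hxN (inv_mem hxN))
  have htop := adjoin_tower_eq_top L M hgen hyN
  rw [ha] at haM
  subst hM
  have hpint : IsIntegral L p :=
    IsIntegral.of_pow three_pos (isIntegral_algebraMap (x := (⟨p ^ 3, hp3⟩ : L)))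
  have halg := isAlgebraic_of_tower_eq_top hpint hx haM htop
  have hηx3 : η (η (η x)) = x⁻¹ := by
    simp only [hηx, hηy, map_inv₀, map_mul]
    field_simp
  have hfix : L.toSubalgebra = fixedSubalgebra η := by
    ext f
    exact ⟨hLη f, fixed_mem_of_tower L η hLη ho2 hoL hp3 hηp hx hxx hηx3 haM htop⟩
  subst hL
  have hrange : IntermediateField.adjoin k (Set.range ![x, y]) = ⊤ := by
    rwa [Matrix.range_cons_cons_empty]
  obtain ⟨φ, hφ, hφr⟩ := hind.exists_algHom hrange (hind.of_isAlgebraic_adjoin halg)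
  have hφx : φ x = V := hφ 0
  have hφy : φ y = W := hφ 1
  have hφP := PoissonBracket.map_bracket_of_adjoin_pair P P φ hgen
    (by rw [hP, map_mul, hφx, hφy, hWV])
  have hr : φ.range = fixedSubalgebra η := by
    rw [← hfix, ← hφr, AlgHom.fieldRange_toSubalgebra]
  let e : F ≃ₐ[k] fixedSubalgebra η :=
    (AlgEquiv.ofInjective φ φ.toRingHom.injective).trans (Subalgebra.equivOfEq _ _ hr)
  have he : ∀ f, (e f : F) = φ f := fun f => rfl
  refine ⟨e.symm, fun u v huv => ?_⟩
  rw [AlgEquiv.symm_apply_eq]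
  apply Subtype.ext
  rw [he, hφP, ← he, ← he, AlgEquiv.apply_symm_apply, AlgEquiv.apply_symm_apply]
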